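/- Let E be a field of characteristic p > 0, q = p^m with m ≥ 1, d ≥ 1 an integer, and A = (a_{j,l}) an invertible d×d matrix with entries in E. Fix an algebraic closure Ω of E. Then the set of solutions x = (x_1, …, x_d) ∈ Ω^d of the system x_j^q = Σ_{l=1}^d a_{j,l} x_l (for 1 ≤ j ≤ d) has exactly q^d elements, and every coordinate of every solution is separable (hence lies in the separable closure of E inside Ω). -/

import Mathlib

open scoped Matrix

open Polynomial in
/-- The polynomials `P 0 = c 0 X ^ q`, `P (i + 1) = P i ^ q + c (i + 1) X ^ q`. -/
noncomputable def frobeniusIterPoly {K : Type*} [Field K] (q : ℕ) (c : ℕ → K) : ℕ → K[X]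
  | 0 => C (c 0) * X ^ q
  | i + 1 => frobeniusIterPoly q c i ^ q + C (c (i + 1)) * X ^ q

section FrobeniusIterPoly

open Polynomial

variable {K : Type*} [Field K] {q : ℕ} (c : ℕ → K)

theorem X_pow_dvd_frobeniusIterPoly (hq : 2 ≤ q) (i : ℕ) : X ^ q ∣ frobeniusIterPoly q c i := by
  induction i with
  | zero => exact dvd_mul_left _ _
  | succ i ih =>
    exact dvd_add (ih.trans (dvd_pow_self _ (by lia))) (dvd_mul_left _ _)

theorem coeff_eq_zero_of_frobeniusIterPoly_eq_zero (hq : 2 ≤ q) {i : ℕ}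
    (h : frobeniusIterPoly q c i = 0) : ∀ j ≤ i, c j = 0 := by
  induction i with
  | zero =>
    intro j hj
    obtain rfl : j = 0 := by lia
    simpa [frobeniusIterPoly] using h
  | succ i ih =>
    have hdvd : X ^ (q * q) ∣ frobeniusIterPoly q c i ^ q := by
      rw [pow_mul]
      exact pow_dvd_pow_of_dvd (X_pow_dvd_frobeniusIterPoly c hq i) q
    have hcoeff : (frobeniusIterPoly q c i ^ q).coeff q = 0 :=
      X_pow_dvd_iff.mp hdvd q (by nlinarith)
    have hc : c (i + 1) = 0 := by
      simpa [frobeniusIterPoly, hcoeff] using congr_arg (coeff · q) h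
    have hP : frobeniusIterPoly q c i = 0 := by
      rw [frobeniusIterPoly, hc, C_0, zero_mul, add_zero] at h
      exact (pow_eq_zero_iff (by lia)).mp h
    intro j hj
    rcases hj.lt_or_eq with hj | rfl
    · exact ih hP j (by lia)
    · exact hc

theorem exists_ne_zero_eval_frobeniusIterPoly_eq_self [IsAlgClosed K] (hq : 2 ≤ q) {i : ℕ}
    (h : ∃ j ≤ i, c j ≠ 0) : ∃ t : K, t ≠ 0 ∧ (frobeniusIterPoly q c i).eval t = t := by
  obtain ⟨R, hR⟩ := (pow_dvd_pow X hq).trans (X_pow_dvd_frobeniusIterPoly c hq i)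
  have hR0 : R ≠ 0 := by
    rintro rfl
    obtain ⟨j, hj, hcj⟩ := h
    exact hcj (coeff_eq_zero_of_frobeniusIterPoly_eq_zero c hq (by simpa using hR) j hj)
  have hdeg : (R * X - C 1).degree ≠ 0 := by
    have h1 : (0 : WithBot ℕ) < (R * X).degree := by
      rw [← natDegree_pos_iff_degree_pos, natDegree_mul_X hR0]
      lia
    rw [degree_sub_C h1]
    exact h1.ne'
  obtain ⟨t, ht⟩ := IsAlgClosed.exists_root _ hdeg
  have ht' : R.eval t * t = 1 := by simpa [IsRoot, sub_eq_zero] using ht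
  refine ⟨t, right_ne_zero_of_mul_eq_one ht', ?_⟩
  rw [hR]
  simp only [eval_mul, eval_pow, eval_X]
  linear_combination t * ht'

end FrobeniusIterPoly

theorem exists_linearIndependent_iterate_and_eq_sum {K V : Type*} [Field K] [AddCommGroup V]
    [Module K V] [FiniteDimensional K V] (f : V → V) {v : V} (hv : v ≠ 0) :
    ∃ (s : ℕ) (c : ℕ → K), LinearIndependent K (fun i : Fin (s + 1) ↦ f^[i] v) ∧
      f^[s + 1] v = ∑ i ∈ Finset.range (s + 1), c i • f^[i] v := by
  classical
  have hex : ∃ n, ¬ LinearIndependent K (fun i : Fin n ↦ f^[i] v) :=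
    ⟨Module.finrank K V + 1, fun h ↦ by simpa using h.fintype_card_le_finrank⟩
  obtain ⟨n, hn, hmin⟩ : ∃ n, ¬ LinearIndependent K (fun i : Fin n ↦ f^[i] v) ∧
      ∀ k < n, LinearIndependent K (fun i : Fin k ↦ f^[i] v) :=
    ⟨Nat.find hex, Nat.find_spec hex, fun k hk ↦ not_not.mp (Nat.find_min hex hk)⟩
  match n, hn, hmin with
  | 0, hn, _ => exact absurd linearIndependent_empty_type hn
  | 1, hn, _ => exact absurd (LinearIndependent.of_subsingleton 0 (by simpa using hv)) hn
  | s + 2, hn, hmin =>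
    have hli := hmin (s + 1) (by lia)
    rw [linearIndependent_finSucc'] at hn
    have hmem : f^[s + 1] v ∈ Submodule.span K (Set.range fun i : Fin (s + 1) ↦ f^[i] v) :=
      by_contra fun hmem ↦ hn ⟨hli, hmem⟩
    obtain ⟨c, hc⟩ := (Submodule.mem_span_range_iff_exists_fun K).mp hmem
    refine ⟨s, fun i ↦ if h : i < s + 1 then c ⟨i, h⟩ else 0, hli, ?_⟩
    rw [← hc, Finset.sum_range]
    simp only [Fin.is_lt, dif_pos]

theorem ncard_pow_eq_self {K : Type*} [Field K] [IsAlgClosed K] {q : ℕ} (hq : 2 ≤ q)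
    (hqK : (q : K) = 0) : {t : K | t ^ q = t}.ncard = q := by
  classical
  have hsep : (Polynomial.X ^ q - Polynomial.X : Polynomial K).Separable :=
    galois_poly_separable (ringChar K) q (ringChar.dvd hqK)
  have hset : {t : K | t ^ q = t} = (Polynomial.X ^ q - Polynomial.X : Polynomial K).rootSet K := by
    ext t
    simp [Polynomial.mem_rootSet, hsep.ne_zero, sub_eq_zero]
  rw [hset, ← Nat.card_coe_set_eq, Nat.card_eq_fintype_card,
    Polynomial.card_rootSet_eq_natDegree hsep (IsAlgClosed.splits _),
    FiniteField.X_pow_card_sub_X_natDegree_eq K (by lia)]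

section FrobeniusSemilinear

variable {K V : Type*} [Field K] [IsAlgClosed K] [AddCommGroup V] [Module K V]
  [FiniteDimensional K V] {q : ℕ} {σ : K →+* K}

theorem exists_ne_zero_fixed_of_frobenius_semilinear (hq : 2 ≤ q) (hσ : ∀ a, σ a = a ^ q)
    (φ : V →ₛₗ[σ] V) (hφ : ∀ x, φ x = 0 → x = 0) [Nontrivial V] : ∃ w : V, w ≠ 0 ∧ φ w = w := by
  obtain ⟨v, hv⟩ := exists_ne (0 : V)
  obtain ⟨s, c, hli, hc⟩ := exists_linearIndependent_iterate_and_eq_sum (K := K) φ hv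
  have hne : ∀ n, φ^[n] v ≠ 0 := by
    intro n
    induction n with
    | zero => exact hv
    | succ n ih =>
      rw [Function.iterate_succ_apply']
      exact fun h ↦ ih (hφ _ h)
  have hc0 : ∃ j ≤ s, c j ≠ 0 := by
    by_contra! h
    refine hne (s + 1) (hc.trans (Finset.sum_eq_zero fun i hi ↦ ?_))
    rw [h i (by simpa [Nat.lt_succ_iff] using hi), zero_smul]
  obtain ⟨T, hT, hPT⟩ := exists_ne_zero_eval_frobeniusIterPoly_eq_self c hq hc0
  set t : ℕ → K := fun i ↦ (frobeniusIterPoly q c i).eval T with ht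
  have ht0 : t 0 = c 0 * T ^ q := by simp [ht, frobeniusIterPoly]
  have htsucc : ∀ i, t (i + 1) = t i ^ q + c (i + 1) * T ^ q := by simp [ht, frobeniusIterPoly]
  have hts : t s = T := hPT
  refine ⟨∑ i ∈ Finset.range (s + 1), t i • φ^[i] v, fun h ↦ hT ?_, ?_⟩
  · rw [Finset.sum_range] at h
    rw [← hts]
    simpa using Fintype.linearIndependent_iff.mp hli (fun i ↦ t i) h (Fin.last s)
  · calc φ (∑ i ∈ Finset.range (s + 1), t i • φ^[i] v)
        = ∑ i ∈ Finset.range (s + 1), t i ^ q • φ^[i + 1] v := by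
          simp [hσ, Function.iterate_succ_apply', -Function.iterate_succ]
      _ = ∑ i ∈ Finset.range s, t i ^ q • φ^[i + 1] v
            + T ^ q • ∑ i ∈ Finset.range (s + 1), c i • φ^[i] v := by
          rw [Finset.sum_range_succ, hts, hc]
      _ = ∑ i ∈ Finset.range (s + 1), t i • φ^[i] v := by
          rw [Finset.sum_range_succ', Finset.sum_range_succ', ht0, smul_add, Finset.smul_sum,
            ← add_assoc, ← Finset.sum_add_distrib, smul_smul, mul_comm (T ^ q)]
          congr 1
          refine Finset.sum_congr rfl fun i _ ↦ ?_
          rw [htsucc, add_smul, smul_smul, mul_comm (T ^ q)]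

theorem span_fixed_eq_top_of_frobenius_semilinear (hq : 2 ≤ q) (hσ : ∀ a, σ a = a ^ q)
    (φ : V →ₛₗ[σ] V) (hφ : ∀ x, φ x = 0 → x = 0) :
    Submodule.span K {x | φ x = x} = ⊤ := by
  set W := Submodule.span K {x | φ x = x}
  have hmap : ∀ x ∈ W, φ x ∈ W := by
    intro x hx
    induction hx using Submodule.span_induction with
    | mem x hx => exact hx.symm ▸ Submodule.subset_span hx
    | zero => simp
    | add x y _ _ hx hy => simpa using W.add_mem hx hy
    | smul a x _ hx => simpa using W.smul_mem _ hx
  have hsurj : ∀ x ∈ W, ∃ y ∈ W, φ y = x := by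
    intro x hx
    induction hx using Submodule.span_induction with
    | mem x hx => exact ⟨x, Submodule.subset_span hx, hx⟩
    | zero => exact ⟨0, W.zero_mem, map_zero φ⟩
    | add x y _ _ hx hy =>
      obtain ⟨x', hx', rfl⟩ := hx
      obtain ⟨y', hy', rfl⟩ := hy
      exact ⟨x' + y', W.add_mem hx' hy', map_add φ _ _⟩
    | smul a x _ hx =>
      obtain ⟨x', hx', rfl⟩ := hx
      obtain ⟨b, rfl⟩ := IsAlgClosed.exists_pow_nat_eq a (by lia : 0 < q)
      exact ⟨b • x', W.smul_mem _ hx', by simp [hσ]⟩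
  have hsub : ∀ x ∈ W, ∃ y ∈ W, φ y - y = x := by
    intro x hx
    induction hx using Submodule.closure_induction with
    | zero => exact ⟨0, W.zero_mem, by simp⟩
    | add x y _ _ hx hy =>
      obtain ⟨x', hx', rfl⟩ := hx
      obtain ⟨y', hy', rfl⟩ := hy
      exact ⟨x' + y', W.add_mem hx' hy', by rw [map_add]; abel⟩
    | smul_mem a x hx =>
      obtain ⟨b, hb⟩ := IsAlgClosed.exists_root (Polynomial.X ^ q - Polynomial.X - Polynomial.C a)
        (by
          rw [sub_sub, Polynomial.degree_sub_eq_left_of_degree_lt, Polynomial.degree_X_pow]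
          · exact_mod_cast (by lia : q ≠ 0)
          · rw [Polynomial.degree_X_add_C, Polynomial.degree_X_pow]
            exact_mod_cast hq)
      refine ⟨b • x, W.smul_mem _ (Submodule.subset_span hx), ?_⟩
      have hb' : b ^ q - b = a := by simpa [sub_eq_zero] using hb
      rw [map_smulₛₗ, hσ, show φ x = x from hx, ← sub_smul, hb']
  by_contra hne
  have : Nontrivial (V ⧸ W) := Submodule.Quotient.nontrivial_iff.mpr hne
  obtain ⟨w, hw0, hw⟩ := exists_ne_zero_fixed_of_frobenius_semilinear hq hσ (W.mapQ W φ hmap) (by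
    intro x hx
    obtain ⟨u, rfl⟩ := W.mkQ_surjective x
    have hu : φ u ∈ W := by simpa using hx
    obtain ⟨y, hy, hyu⟩ := hsurj _ hu
    have : u - y = 0 := hφ _ (by rw [map_sub, hyu, sub_self])
    rw [sub_eq_zero.mp this]
    simpa using hy)
  obtain ⟨u, rfl⟩ := W.mkQ_surjective w
  have hu : u - φ u ∈ W := by
    rw [← Submodule.Quotient.eq]
    simpa using hw.symm
  obtain ⟨y, hy, hyu⟩ := hsub _ hu
  have hfix : u + y ∈ W := Submodule.subset_span (show φ (u + y) = u + y by
    rw [map_add, ← sub_eq_zero]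
    rw [← sub_eq_zero] at hyu
    rw [← hyu]
    abel)
  exact hw0 (by simpa using (W.add_mem_iff_left hy).mp hfix)

theorem ncard_fixed_of_frobenius_semilinear (hq : 2 ≤ q) (hqK : (q : K) = 0)
    (hσ : ∀ a, σ a = a ^ q) (φ : V →ₛₗ[σ] V) (hφ : ∀ x, φ x = 0 → x = 0) :
    {x | φ x = x}.ncard = q ^ Module.finrank K V := by
  have hspan := (span_fixed_eq_top_of_frobenius_semilinear hq hσ φ hφ).ge
  obtain ⟨b, hb⟩ : ∃ b : Module.Basis (Fin (Module.finrank K V)) K V, ∀ i, φ (b i) = b i := by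
    let b := Module.Basis.ofSpan hspan
    have := Module.Finite.finite_basis b
    have := Fintype.ofFinite
    let e := Fintype.equivFinOfCardEq (Module.finrank_eq_card_basis b).symm
    refine ⟨b.reindex e, fun i ↦ ?_⟩
    rw [Module.Basis.reindex_apply]
    exact Module.Basis.ofSpan_subset hspan ⟨_, rfl⟩
  have hfix : ∀ x, φ x = x ↔ ∀ i, b.equivFun x i ∈ {t : K | t ^ q = t} := by
    intro x
    have hx : φ x = ∑ i, b.equivFun x i ^ q • b i := by
      conv_lhs => rw [← b.sum_equivFun x]
      simp only [map_sum, map_smulₛₗ, hσ, hb]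
    rw [← b.equivFun.injective.eq_iff, hx, ← b.equivFun_symm_apply, LinearEquiv.apply_symm_apply,
      funext_iff]
    rfl
  have e : {x | φ x = x} ≃ (Fin (Module.finrank K V) → {t : K | t ^ q = t}) :=
    (b.equivFun.toEquiv.subtypeEquiv hfix).trans Equiv.subtypePiEquivPi
  rw [← Nat.card_coe_set_eq, Nat.card_congr e, Nat.card_pi, Finset.prod_const, Nat.card_coe_set_eq,
    ncard_pow_eq_self hq hqK, Finset.card_univ, Fintype.card_fin]

end FrobeniusSemilinear

theorem isSeparable_of_pow_eq_sum {E Ω : Type*} [Field E] [Field Ω] [Algebra E Ω]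
    [Algebra.IsAlgebraic E Ω] {p : ℕ} [Fact p.Prime] [CharP E p] {m : ℕ} (hm : 1 ≤ m)
    {ι : Type*} [Fintype ι] (B : Matrix ι ι E) {x : ι → Ω}
    (hx : ∀ j, x j = ∑ l, algebraMap E Ω (B j l) * x l ^ p ^ m) (j : ι) :
    IsSeparable E (x j) := by
  have := charP_of_injective_algebraMap (algebraMap E Ω).injective p
  rw [← mem_separableClosure_iff]
  set S := separableClosure E Ω
  have := charP_of_injective_algebraMap (algebraMap E S).injective p
  have hpow : ∀ j, ∃ n, x j ^ p ^ n ∈ S := fun j ↦ by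
    obtain ⟨n, y, hy⟩ := IsPurelyInseparable.pow_mem S p (x j)
    exact ⟨n, hy ▸ y.2⟩
  choose n hn using hpow
  have hmono : ∀ j k, n j ≤ k → x j ^ p ^ k ∈ S := fun j k hk ↦ by
    rw [← Nat.add_sub_cancel' hk, pow_add, pow_mul]
    exact pow_mem (hn j) _
  have hall : ∀ j, x j ^ p ^ (m * ∑ i, n i) ∈ S := fun j ↦
    hmono j _ ((Finset.single_le_sum (fun _ _ ↦ Nat.zero_le _) (Finset.mem_univ j)).trans
      (Nat.le_mul_of_pos_left _ hm))
  have hdesc : ∀ N, (∀ j, x j ^ p ^ (m * N) ∈ S) → ∀ j, x j ∈ S := by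
    intro N
    induction N with
    | zero => simp
    | succ N ih =>
      refine fun h ↦ ih fun j ↦ ?_
      rw [hx j, sum_pow_char_pow]
      refine sum_mem fun l _ ↦ ?_
      rw [mul_pow, ← pow_mul, ← pow_add, ← map_pow, add_comm, ← Nat.mul_succ]
      exact mul_mem (S.algebraMap_mem _) (h l)
  exact hdesc _ hall j


/-- Let `E` be a field of characteristic `p > 0`, `q = p^m` (`m ≥ 1`), `d ≥ 1`, and `A` an
invertible `d × d` matrix over `E`. In an algebraic closure `Ω` of `E`, the set of
solutions of the system `x_j^q = ∑_l A_{j,l} x_l` has exactly `q^d` elements, and every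
coordinate of every solution is separable over `E`. -/
theorem stmt_6 (p : ℕ) (hp : p.Prime) (E : Type*) [Field E] [CharP E p]
    (m : ℕ) (hm : 1 ≤ m) (q : ℕ) (hq : q = p ^ m)
    (d : ℕ) (hd : 1 ≤ d) (A : Matrix (Fin d) (Fin d) E) (hA : IsUnit A)
    (Ω : Type*) [Field Ω] [Algebra E Ω] [IsAlgClosure E Ω] :
    ({x : Fin d → Ω | ∀ j, x j ^ q = ∑ l, algebraMap E Ω (A j l) * x l}.ncard = q ^ d) ∧
      ∀ x ∈ {x : Fin d → Ω | ∀ j, x j ^ q = ∑ l, algebraMap E Ω (A j l) * x l},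
        ∀ j, IsSeparable E (x j) := by
  have := Fact.mk hp
  have : IsAlgClosed Ω := IsAlgClosure.isAlgClosed E
  have : Algebra.IsAlgebraic E Ω := IsAlgClosure.isAlgebraic
  have := charP_of_injective_algebraMap (algebraMap E Ω).injective p
  have hdet : IsUnit A.det := (Matrix.isUnit_iff_isUnit_det A).mp hA
  have hq2 : 2 ≤ q := hq ▸ hp.two_le.trans (Nat.le_self_pow (by lia) p)
  have hqΩ : (q : Ω) = 0 := by simp [hq, show m ≠ 0 by lia]
  let f := algebraMap E Ω
  let σ : Ω →+* Ω := iterateFrobenius Ω p m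
  have hσ : ∀ a, σ a = a ^ q := fun a ↦ hq ▸ iterateFrobenius_def p m a
  have hinv : (A⁻¹).map f * A.map f = 1 := by
    rw [← Matrix.map_mul, Matrix.nonsing_inv_mul A hdet]
    simp
  have hinv' : A.map f * (A⁻¹).map f = 1 := mul_eq_one_comm.mp hinv
  have hiff : ∀ x : Fin d → Ω, (∀ j, x j ^ q = ∑ l, f (A j l) * x l) ↔
      (A⁻¹).map f *ᵥ (fun j ↦ x j ^ q) = x := by
    intro x
    have h : (∀ j, x j ^ q = ∑ l, f (A j l) * x l) ↔ (fun j ↦ x j ^ q) = A.map f *ᵥ x :=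
      funext_iff.symm
    rw [h]
    constructor
    · intro h
      rw [h, Matrix.mulVec_mulVec, hinv, Matrix.one_mulVec]
    · intro h
      conv_rhs => rw [← h]
      rw [Matrix.mulVec_mulVec, hinv', Matrix.one_mulVec]
  constructor
  · let φ : (Fin d → Ω) →ₛₗ[σ] (Fin d → Ω) :=
      { toFun := fun x ↦ (A⁻¹).map f *ᵥ (fun j ↦ σ (x j))
        map_add' := fun x y ↦ by
          rw [← Matrix.mulVec_add]
          congr 1
          ext j
          simp
        map_smul' := fun a x ↦ by
          rw [← Matrix.mulVec_smul]
          congr 1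
          ext j
          simp }
    have hφ : ∀ x, φ x = 0 → x = 0 := by
      intro x hx
      have h := congr_arg (A.map f *ᵥ ·) (show (A⁻¹).map f *ᵥ (fun j ↦ σ (x j)) = 0 from hx)
      simp only [Matrix.mulVec_mulVec, hinv', Matrix.one_mulVec, Matrix.mulVec_zero] at h
      ext j
      simpa using congr_fun h j
    have hset : {x : Fin d → Ω | ∀ j, x j ^ q = ∑ l, f (A j l) * x l} = {x | φ x = x} := by
      ext x
      refine (hiff x).trans ?_
      simp only [← hσ]
      rfl
    rw [hset, ncard_fixed_of_frobenius_semilinear hq2 hqΩ hσ φ hφ, Module.finrank_fin_fun]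
  · intro x hx j
    refine isSeparable_of_pow_eq_sum (p := p) hm A⁻¹ (fun j ↦ ?_) j
    rw [← hq]
    exact (congr_fun ((hiff x).mp hx) j).symm
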